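/- Let ψ : ℝ → ℝ be continuous and bounded in absolute value by a polynomial, and fix s1, s2 > 0. Define κ : [-1,1] → ℝ by κ(ρ) = E[ ψ(s1·G1) · ψ( s2·(ρ·G1 + √(1−ρ²)·G2) ) ] for independent standard Gaussians G1, G2. Then κ is continuous on the closed interval [-1,1]; in particular lim_{ρ→1⁻} κ(ρ) = E[ψ(s1·G1)·ψ(s2·G1)] and lim_{ρ→−1⁺} κ(ρ) = E[ψ(s1·G1)·ψ(−s2·G1)]. Moreover, if ψ is continuously differentiable with |ψ'| also bounded by a polynomial and M := sup_{ρ∈(-1,1)} s1·s2·|E[ψ'(s1·Z1)·ψ'(s2·Z2)]| is finite (where (Z1, Z2) has correlation ρ), then κ is Lipschitz on [-1,1] with constant M: |κ(ρ1) − κ(ρ0)| ≤ M·|ρ1 − ρ0| for all ρ0, ρ1 ∈ [-1,1]. -/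

import Mathlib

open Real MeasureTheory Filter Topology Set

/-- Standard Gaussian probability density function. -/
noncomputable def gpdf (x : ℝ) : ℝ := (Real.sqrt (2 * Real.pi))⁻¹ * Real.exp (-(x ^ 2) / 2)

open ProbabilityTheory

/-- A family of real functions bounded by a common polynomial in the norm. -/
def UnifPolyGrowth {ι E : Type*} [Norm E] (F : ι → E → ℝ) : Prop :=
  ∃ C : ℝ, ∃ k : ℕ, 0 ≤ C ∧ ∀ i p, |F i p| ≤ C * (1 + ‖p‖) ^ k

/-- A real function bounded by a polynomial in the norm. -/
def PolyGrowth {E : Type*} [Norm E] (f : E → ℝ) : Prop :=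
  ∃ C : ℝ, ∃ k : ℕ, 0 ≤ C ∧ ∀ p, |f p| ≤ C * (1 + ‖p‖) ^ k

section Growth

variable {ι E : Type*} [NormedAddCommGroup E]

lemma UnifPolyGrowth.apply {F : ι → E → ℝ} (hF : UnifPolyGrowth F) (i : ι) :
    PolyGrowth (F i) := by
  obtain ⟨C, k, hC, h⟩ := hF
  exact ⟨C, k, hC, h i⟩

lemma UnifPolyGrowth.mul {F G : ι → E → ℝ} (hF : UnifPolyGrowth F) (hG : UnifPolyGrowth G) :
    UnifPolyGrowth fun i p ↦ F i p * G i p := by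
  obtain ⟨C, k, hC, h⟩ := hF
  obtain ⟨D, l, hD, h'⟩ := hG
  refine ⟨C * D, k + l, by positivity, fun i p ↦ ?_⟩
  rw [abs_mul]
  calc |F i p| * |G i p| ≤ (C * (1 + ‖p‖) ^ k) * (D * (1 + ‖p‖) ^ l) := by
        gcongr
        · exact h i p
        · exact h' i p
    _ = C * D * (1 + ‖p‖) ^ (k + l) := by ring

lemma PolyGrowth.comp_le {f : ℝ → ℝ} (hf : PolyGrowth f) {u : ι → E → ℝ} {L : ℝ} (hL : 0 ≤ L)
    (hu : ∀ i p, |u i p| ≤ L * (1 + ‖p‖)) : UnifPolyGrowth fun i p ↦ f (u i p) := by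
  obtain ⟨C, k, hC, h⟩ := hf
  refine ⟨C * (1 + L) ^ k, k, by positivity, fun i p ↦ (h _).trans ?_⟩
  rw [mul_assoc, ← mul_pow]
  gcongr
  rw [Real.norm_eq_abs]
  nlinarith [hu i p, norm_nonneg p]

lemma UnifPolyGrowth.of_le {u : ι → E → ℝ} {L : ℝ} (hL : 0 ≤ L)
    (hu : ∀ i p, |u i p| ≤ L * (1 + ‖p‖)) : UnifPolyGrowth u :=
  ⟨L, 1, hL, by simpa using hu⟩

lemma PolyGrowth.unif {f : E → ℝ} (hf : PolyGrowth f) : UnifPolyGrowth fun _ : ι ↦ f := by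
  obtain ⟨C, k, hC, h⟩ := hf
  exact ⟨C, k, hC, fun _ ↦ h⟩

lemma PolyGrowth.mul {f g : E → ℝ} (hf : PolyGrowth f) (hg : PolyGrowth g) :
    PolyGrowth fun p ↦ f p * g p :=
  (hf.unif.mul hg.unif : UnifPolyGrowth fun (_ : Unit) p ↦ f p * g p).apply ()

lemma PolyGrowth.comp_const_mul {f : ℝ → ℝ} (hf : PolyGrowth f) (s : ℝ) :
    PolyGrowth fun x ↦ f (s * x) := by
  refine (hf.comp_le (u := fun (_ : Unit) x ↦ s * x) (abs_nonneg s) fun _ x ↦ ?_).apply ()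
  rw [abs_mul, Real.norm_eq_abs]
  nlinarith [abs_nonneg s]

variable [NormedSpace ℝ E] [MeasurableSpace E] [BorelSpace E] [SecondCountableTopology E]
  [CompleteSpace E]

lemma integrable_one_add_norm_pow (μ : Measure E) [IsGaussian μ] (k : ℕ) :
    Integrable (fun p ↦ (1 + ‖p‖) ^ k) μ := by
  have h1 : MemLp (fun p : E ↦ ‖p‖) k μ := (IsGaussian.memLp_id μ k (by simp)).norm
  have h : MemLp (fun p : E ↦ 1 + ‖p‖) k μ := (memLp_const (1 : ℝ)).add h1
  refine h.integrable_norm_pow'.congr (.of_forall fun p ↦ ?_)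
  simp only [Real.norm_eq_abs]
  rw [abs_of_nonneg (by positivity)]

lemma PolyGrowth.integrable {f : E → ℝ} (hf : PolyGrowth f) (hc : Continuous f)
    (μ : Measure E) [IsGaussian μ] : Integrable f μ := by
  obtain ⟨C, k, -, h⟩ := hf
  exact ((integrable_one_add_norm_pow μ k).const_mul C).mono' hc.aestronglyMeasurable
    (.of_forall h)

end Growth

lemma gpdf_eq_gaussianPDFReal : gpdf = gaussianPDFReal 0 1 := by
  ext x
  simp [gpdf, gaussianPDFReal]

lemma integral_mul_gpdf (f : ℝ → ℝ) : ∫ x, f x * gpdf x = ∫ x, f x ∂gaussianReal 0 1 := by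
  rw [integral_gaussianReal_eq_integral_smul one_ne_zero, gpdf_eq_gaussianPDFReal]
  simp [mul_comm]

lemma integral_integral_mul_gpdf (f : ℝ → ℝ → ℝ) :
    ∫ x, ∫ y, f x y * gpdf x * gpdf y
      = ∫ x, ∫ y, f x y ∂gaussianReal 0 1 ∂gaussianReal 0 1 := by
  simp_rw [integral_mul_gpdf, integral_mul_const, integral_mul_gpdf]

lemma PolyGrowth.integrable_mul_gpdf {f : ℝ → ℝ} (hf : PolyGrowth f) (hc : Continuous f) :
    Integrable fun x ↦ f x * gpdf x := by
  have h := hf.integrable hc (gaussianReal 0 1)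
  rw [gaussianReal_of_var_ne_zero _ one_ne_zero,
    integrable_withDensity_iff (measurable_gaussianPDF _ _)
      (.of_forall fun _ ↦ gaussianPDF_lt_top)] at h
  simpa [gpdf_eq_gaussianPDFReal] using h

lemma hasDerivAt_gpdf (x : ℝ) : HasDerivAt gpdf (-(x * gpdf x)) x := by
  have h := (((hasDerivAt_pow 2 x).neg.div_const 2).exp).const_mul (√(2 * π))⁻¹
  refine HasDerivAt.congr_deriv h ?_
  simp only [gpdf, Pi.neg_apply]
  ring

/-- **Gaussian integration by parts** (Stein's identity). -/
lemma integral_mul_id_gaussianReal {f f' : ℝ → ℝ} (hf : PolyGrowth f)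
    (hf' : PolyGrowth f') (hd : ∀ x, HasDerivAt f (f' x) x) (hc' : Continuous f') :
    ∫ x, f x * x ∂gaussianReal 0 1 = ∫ x, f' x ∂gaussianReal 0 1 := by
  have hc : Continuous f := continuous_iff_continuousAt.2 fun x ↦ (hd x).continuousAt
  have hid : PolyGrowth fun x : ℝ ↦ x :=
    ⟨1, 1, zero_le_one, fun x ↦ by simp⟩
  have key := integral_mul_deriv_eq_deriv_mul_of_integrable (u := f) (v := gpdf)
    (fun x _ ↦ hd x) (fun x _ ↦ hasDerivAt_gpdf x)
    (by
      convert! ((hf.mul hid).integrable_mul_gpdf (hc.mul continuous_id)).neg using 1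
      ext x
      simp [mul_assoc])
    (hf'.integrable_mul_gpdf hc') (hf.integrable_mul_gpdf hc)
  rw [← integral_mul_gpdf, ← integral_mul_gpdf, ← neg_inj, ← key, ← integral_neg]
  congr 1 with x
  ring

lemma map_rotation_gaussianReal_prod (θ : ℝ) :
    ((gaussianReal 0 1).prod (gaussianReal 0 1)).map (ContinuousLinearMap.rotation θ)
      = (gaussianReal 0 1).prod (gaussianReal 0 1) :=
  IsGaussian.map_rotation_eq_self (by simp) θ

lemma integral_comp_rotation {f : ℝ × ℝ → ℝ} (hf : Continuous f) (θ : ℝ) :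
    ∫ p, f (Real.cos θ * p.1 + Real.sin θ * p.2, -Real.sin θ * p.1 + Real.cos θ * p.2)
        ∂(gaussianReal 0 1).prod (gaussianReal 0 1)
      = ∫ p, f p ∂(gaussianReal 0 1).prod (gaussianReal 0 1) := by
  conv_rhs => rw [← map_rotation_gaussianReal_prod θ]
  rw [integral_map (by fun_prop) hf.aestronglyMeasurable]
  simp [ContinuousLinearMap.rotation_apply]

lemma abs_mul_fst_add_mul_snd_le {a b : ℝ} (ha : |a| ≤ 1) (hb : |b| ≤ 1) (p : ℝ × ℝ) :
    |a * p.1 + b * p.2| ≤ 2 * (1 + ‖p‖) := by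
  have h1 : |p.1| ≤ ‖p‖ := norm_fst_le p
  have h2 : |p.2| ≤ ‖p‖ := norm_snd_le p
  have h3 := abs_add_le (a * p.1) (b * p.2)
  rw [abs_mul, abs_mul] at h3
  nlinarith [abs_nonneg p.1, abs_nonneg p.2]

/-- The expectation of `f G₁ * g (cos θ * G₁ + sin θ * G₂)` for independent standard Gaussians. -/
noncomputable def rotationKernel (f g : ℝ → ℝ) (θ : ℝ) : ℝ :=
  ∫ p : ℝ × ℝ, f p.1 * g (Real.cos θ * p.1 + Real.sin θ * p.2)
    ∂(gaussianReal 0 1).prod (gaussianReal 0 1)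

section RotationKernel

variable {f g : ℝ → ℝ}

lemma unifPolyGrowth_comp_fst (hf : PolyGrowth f) :
    UnifPolyGrowth fun (_ : ℝ) (p : ℝ × ℝ) ↦ f p.1 :=
  hf.comp_le zero_le_two fun _ p ↦ by
    simpa using abs_mul_fst_add_mul_snd_le (a := 1) (b := 0) (by simp) (by simp) p

lemma unifPolyGrowth_comp_rotation (hg : PolyGrowth g) :
    UnifPolyGrowth fun (θ : ℝ) (p : ℝ × ℝ) ↦ g (Real.cos θ * p.1 + Real.sin θ * p.2) :=
  hg.comp_le zero_le_two fun θ p ↦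
    abs_mul_fst_add_mul_snd_le (Real.abs_cos_le_one θ) (Real.abs_sin_le_one θ) p

lemma unifPolyGrowth_rotationKernel (hf : PolyGrowth f) (hg : PolyGrowth g) :
    UnifPolyGrowth fun (θ : ℝ) (p : ℝ × ℝ) ↦
      f p.1 * g (Real.cos θ * p.1 + Real.sin θ * p.2) :=
  (unifPolyGrowth_comp_fst hf).mul (unifPolyGrowth_comp_rotation hg)

lemma rotationKernel_eq_integral_integral (hf : PolyGrowth f) (hg : PolyGrowth g)
    (hfc : Continuous f) (hgc : Continuous g) (θ : ℝ) :
    rotationKernel f g θ = ∫ x, ∫ y, f x * g (Real.cos θ * x + Real.sin θ * y)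
      ∂gaussianReal 0 1 ∂gaussianReal 0 1 :=
  integral_prod _ (((unifPolyGrowth_rotationKernel hf hg).apply θ).integrable
    (by fun_prop) _)

lemma continuous_rotationKernel (hf : PolyGrowth f) (hg : PolyGrowth g)
    (hfc : Continuous f) (hgc : Continuous g) : Continuous (rotationKernel f g) := by
  obtain ⟨C, k, -, h⟩ := unifPolyGrowth_rotationKernel hf hg
  exact continuous_of_dominated (fun θ ↦ Continuous.aestronglyMeasurable (by fun_prop))
    (fun θ ↦ .of_forall (h θ)) ((integrable_one_add_norm_pow _ k).const_mul C)
    (.of_forall fun p ↦ by fun_prop)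

/-- Differentiating the correlation kernel of two rotated Gaussians along the angle. -/
lemma hasDerivAt_rotationKernel {f' g' : ℝ → ℝ} (hf : PolyGrowth f) (hg : PolyGrowth g)
    (hf' : PolyGrowth f') (hg' : PolyGrowth g') (hfd : ∀ x, HasDerivAt f (f' x) x)
    (hgd : ∀ x, HasDerivAt g (g' x) x) (hfc' : Continuous f') (hgc' : Continuous g') (θ : ℝ) :
    HasDerivAt (rotationKernel f g) (-Real.sin θ * rotationKernel f' g' θ) θ := by
  have hfc : Continuous f := continuous_iff_continuousAt.2 fun x ↦ (hfd x).continuousAt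
  have hgc : Continuous g := continuous_iff_continuousAt.2 fun x ↦ (hgd x).continuousAt
  have hw : UnifPolyGrowth fun (θ : ℝ) (p : ℝ × ℝ) ↦ -Real.sin θ * p.1 + Real.cos θ * p.2 :=
    .of_le zero_le_two fun θ p ↦ abs_mul_fst_add_mul_snd_le
      (by simpa using Real.abs_sin_le_one θ) (Real.abs_cos_le_one θ) p
  have hF' := (unifPolyGrowth_rotationKernel hf hg').mul hw
  have hderiv : HasDerivAt (rotationKernel f g)
      (∫ p : ℝ × ℝ, f p.1 * g' (Real.cos θ * p.1 + Real.sin θ * p.2) *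
        (-Real.sin θ * p.1 + Real.cos θ * p.2)
        ∂(gaussianReal 0 1).prod (gaussianReal 0 1)) θ := by
    obtain ⟨C, k, -, h⟩ := hF'
    refine (hasDerivAt_integral_of_dominated_loc_of_deriv_le (s := univ)
      (F' := fun θ (p : ℝ × ℝ) ↦ f p.1 * g' (Real.cos θ * p.1 + Real.sin θ * p.2) *
        (-Real.sin θ * p.1 + Real.cos θ * p.2)) univ_mem
      (.of_forall fun θ ↦ Continuous.aestronglyMeasurable (by fun_prop))
      (((unifPolyGrowth_rotationKernel hf hg).apply θ).integrable (by fun_prop) _)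
      (Continuous.aestronglyMeasurable (by fun_prop))
      (.of_forall fun p θ _ ↦ h θ p) ((integrable_one_add_norm_pow _ k).const_mul C)
      (.of_forall fun p θ _ ↦ ?_)).2
    have h1 : HasDerivAt (fun θ ↦ Real.cos θ * p.1 + Real.sin θ * p.2)
        (-Real.sin θ * p.1 + Real.cos θ * p.2) θ :=
      ((Real.hasDerivAt_cos θ).mul_const p.1).add ((Real.hasDerivAt_sin θ).mul_const p.2)
    convert! ((hgd _).comp θ h1).const_mul (f p.1) using 1
    ring
  convert hderiv using 1
  -- in the rotated coordinates `(u, w)` the first coordinate is `cos θ * u - sin θ * w`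
  have hrot (h : ℝ → ℝ) (v : ℝ × ℝ → ℝ) (hh : Continuous h) (hv : Continuous v) :
      ∫ p : ℝ × ℝ, h p.1 * v (Real.cos θ * p.1 + Real.sin θ * p.2,
          -Real.sin θ * p.1 + Real.cos θ * p.2) ∂(gaussianReal 0 1).prod (gaussianReal 0 1)
        = ∫ p : ℝ × ℝ, h (Real.cos θ * p.1 + -Real.sin θ * p.2) * v p
          ∂(gaussianReal 0 1).prod (gaussianReal 0 1) := by
    rw [← integral_comp_rotation (f := fun p ↦ h (Real.cos θ * p.1 + -Real.sin θ * p.2) * v p)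
      (by fun_prop) θ]
    congr 1 with p
    congr 2
    linear_combination -p.1 * Real.sin_sq_add_cos_sq θ
  have hlin (h : ℝ → ℝ) (hh : PolyGrowth h) :
      PolyGrowth fun p : ℝ × ℝ ↦ h (Real.cos θ * p.1 + -Real.sin θ * p.2) := by
    have := (unifPolyGrowth_comp_rotation hh).apply (-θ)
    simpa using this
  have hsnd : PolyGrowth fun p : ℝ × ℝ ↦ p.2 := by simpa using hw.apply 0
  have hfst (h : ℝ → ℝ) (hh : PolyGrowth h) : PolyGrowth fun p : ℝ × ℝ ↦ h p.1 :=
    (unifPolyGrowth_comp_fst hh).apply 0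
  have hslice (h : ℝ → ℝ) (hh : PolyGrowth h) (u : ℝ) :
      PolyGrowth fun w ↦ h (Real.cos θ * u + -Real.sin θ * w) := by
    refine (hh.comp_le (u := fun (_ : Unit) w ↦ Real.cos θ * u + -Real.sin θ * w)
      (L := |u| + 1) (by positivity) fun _ w ↦ ?_).apply ()
    have h3 := abs_add_le (Real.cos θ * u) (-Real.sin θ * w)
    rw [abs_mul, abs_mul, abs_neg] at h3
    rw [Real.norm_eq_abs]
    nlinarith [abs_nonneg u, abs_nonneg w, Real.abs_cos_le_one θ, Real.abs_sin_le_one θ,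
      mul_nonneg (abs_nonneg u) (abs_nonneg w)]
  have e1 := hrot f (fun q ↦ g' q.1 * q.2) hfc (by fun_prop)
  have e2 := hrot f' (fun q ↦ g' q.1) hfc' (by fun_prop)
  simp only [← mul_assoc] at e1
  rw [rotationKernel, e2, e1, integral_prod _ (((hlin f' hf').mul (hfst g' hg')).integrable
    (by fun_prop) _), integral_prod _ ((((hlin f hf).mul (hfst g' hg')).mul hsnd).integrable
    (by fun_prop) _), ← integral_const_mul]
  congr 1 with u
  have hS := integral_mul_id_gaussianReal (hslice f hf u)
    (f' := fun w ↦ -Real.sin θ * f' (Real.cos θ * u + -Real.sin θ * w))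
    ((show PolyGrowth fun _ : ℝ ↦ -Real.sin θ from
      ⟨|Real.sin θ|, 0, abs_nonneg _, by simp⟩).mul (hslice f' hf' u))
    (fun w ↦ by
      have h1 : HasDerivAt (fun w ↦ Real.cos θ * u + -Real.sin θ * w) (-Real.sin θ) w := by
        simpa using ((hasDerivAt_id w).const_mul (-Real.sin θ)).const_add (Real.cos θ * u)
      convert! (hfd _).comp w h1 using 1
      ring) (by fun_prop)
  rw [integral_const_mul] at hS
  dsimp only
  rw [integral_mul_const, ← mul_assoc, ← hS, ← integral_mul_const]
  congr 1 with w
  ring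

end RotationKernel

/-- For continuous, polynomially bounded `ψ` and `s₁, s₂ > 0`, the kernel
`κ(ρ) = E[ψ(s₁·G₁)·ψ(s₂·(ρ·G₁ + √(1−ρ²)·G₂))]` is continuous on `[-1,1]`; in particular
`κ(ρ) → E[ψ(s₁·G₁)·ψ(s₂·G₁)]` as `ρ → 1⁻` and `κ(ρ) → E[ψ(s₁·G₁)·ψ(−s₂·G₁)]` as
`ρ → −1⁺`.  Moreover, if `ψ` is continuously differentiable with `|ψ'|` also bounded by a
polynomial and `M` bounds `s₁·s₂·|E[ψ'(s₁·Z₁)·ψ'(s₂·Z₂)]|` over `ρ ∈ (-1,1)`, then `κ` is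
Lipschitz on `[-1,1]` with constant `M`. -/
theorem kernel_continuous_on_Icc (ψ : ℝ → ℝ) (hcontψ : Continuous ψ)
    (c : ℝ) (hc : 0 < c) (n : ℕ)
    (hb : ∀ x : ℝ, |ψ x| ≤ c * (1 + |x|) ^ n)
    (s1 s2 : ℝ) (hs1 : 0 < s1) (hs2 : 0 < s2)
    (κ : ℝ → ℝ)
    (hκ : ∀ ρ : ℝ, κ ρ = ∫ x : ℝ, ∫ y : ℝ,
      ψ (s1 * x) * ψ (s2 * (ρ * x + Real.sqrt (1 - ρ ^ 2) * y)) * gpdf x * gpdf y) :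
    ContinuousOn κ (Set.Icc (-1 : ℝ) 1) ∧
    Tendsto κ (nhdsWithin 1 (Set.Iio 1))
      (𝓝 (∫ x : ℝ, ψ (s1 * x) * ψ (s2 * x) * gpdf x)) ∧
    Tendsto κ (nhdsWithin (-1) (Set.Ioi (-1)))
      (𝓝 (∫ x : ℝ, ψ (s1 * x) * ψ (-(s2 * x)) * gpdf x)) ∧
    (ContDiff ℝ 1 ψ →
      (∃ c' > (0 : ℝ), ∃ m : ℕ, ∀ x : ℝ, |deriv ψ x| ≤ c' * (1 + |x|) ^ m) →
      ∀ M : ℝ,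
        (∀ ρ ∈ Set.Ioo (-1 : ℝ) 1,
          s1 * s2 * |∫ x : ℝ, ∫ y : ℝ,
            deriv ψ (s1 * x) * deriv ψ (s2 * (ρ * x + Real.sqrt (1 - ρ ^ 2) * y)) *
              gpdf x * gpdf y| ≤ M) →
        ∀ ρ0 ∈ Set.Icc (-1 : ℝ) 1, ∀ ρ1 ∈ Set.Icc (-1 : ℝ) 1,
          |κ ρ1 - κ ρ0| ≤ M * |ρ1 - ρ0|) := by
  have hg : PolyGrowth ψ := ⟨c, n, hc.le, by simpa using hb⟩
  have hf1 := hg.comp_const_mul s1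
  have hf2 := hg.comp_const_mul s2
  have hK (f g : ℝ → ℝ) (hf : PolyGrowth f) (hg : PolyGrowth g) (hfc : Continuous f)
      (hgc : Continuous g) (ρ : ℝ) (hρ : ρ ∈ Set.Icc (-1 : ℝ) 1) :
      ∫ x : ℝ, ∫ y : ℝ, f x * g (ρ * x + Real.sqrt (1 - ρ ^ 2) * y) * gpdf x * gpdf y
        = rotationKernel f g (Real.arccos ρ) := by
    rw [rotationKernel_eq_integral_integral hf hg hfc hgc, Real.sin_arccos,
      Real.cos_arccos hρ.1 hρ.2]
    exact integral_integral_mul_gpdf fun x y ↦ f x * g (ρ * x + √(1 - ρ ^ 2) * y)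
  have hκK : ∀ ρ ∈ Set.Icc (-1 : ℝ) 1, κ ρ =
      rotationKernel (fun x ↦ ψ (s1 * x)) (fun x ↦ ψ (s2 * x)) (Real.arccos ρ) := fun ρ hρ ↦ by
    rw [hκ, ← hK _ _ hf1 hf2 (by fun_prop) (by fun_prop) ρ hρ]
  have hcont : ContinuousOn κ (Set.Icc (-1 : ℝ) 1) :=
    ((continuous_rotationKernel hf1 hf2 (by fun_prop) (by fun_prop)).comp
      Real.continuous_arccos).continuousOn.congr hκK
  have hend (ρ : ℝ) (hρ : ρ ^ 2 = 1) :
      κ ρ = ∫ x : ℝ, ψ (s1 * x) * ψ (s2 * (ρ * x)) * gpdf x := by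
    rw [hκ, integral_integral_mul_gpdf fun x y ↦ ψ (s1 * x) * ψ (s2 * (ρ * x + √(1 - ρ ^ 2) * y)),
      integral_mul_gpdf]
    simp [hρ]
  refine ⟨hcont, ?_, ?_, fun hψ ⟨c', hc', m, hb'⟩ M hM ↦ ?_⟩
  · have h0 : ContinuousWithinAt κ (Set.Icc (-1) 1) 1 := hcont 1 (by simp)
    have h : ContinuousWithinAt κ (Set.Iio 1) 1 :=
      h0.mono_of_mem_nhdsWithin (Icc_mem_nhdsLT (by norm_num))
    simpa [ContinuousWithinAt, hend 1 (by norm_num)] using h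
  · have h0 : ContinuousWithinAt κ (Set.Icc (-1) 1) (-1) := hcont (-1) (by simp)
    have h : ContinuousWithinAt κ (Set.Ioi (-1)) (-1) :=
      h0.mono_of_mem_nhdsWithin (Icc_mem_nhdsGT (by norm_num))
    simpa [ContinuousWithinAt, hend (-1) (by norm_num)] using h
  · have hdc : Continuous (deriv ψ) := hψ.continuous_deriv le_rfl
    have hdg : PolyGrowth (deriv ψ) := ⟨c', m, hc'.le, by simpa using hb'⟩
    have hd (s x : ℝ) : HasDerivAt (fun x ↦ ψ (s * x)) (s * deriv ψ (s * x)) x := by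
      have h1 : HasDerivAt (fun x ↦ s * x) s x := by simpa using (hasDerivAt_id x).const_mul s
      convert! ((hψ.differentiable one_ne_zero _).hasDerivAt).comp x h1 using 1
      ring
    have hg' (s : ℝ) : PolyGrowth fun x ↦ s * deriv ψ (s * x) :=
      (show PolyGrowth fun _ : ℝ ↦ s from ⟨|s|, 0, abs_nonneg _, by simp⟩).mul
        (hdg.comp_const_mul s)
    have hderiv : ∀ ρ ∈ Set.Ioo (-1 : ℝ) 1, HasDerivAt κ (rotationKernel
        (fun x ↦ s1 * deriv ψ (s1 * x)) (fun x ↦ s2 * deriv ψ (s2 * x)) (Real.arccos ρ)) ρ := by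
      intro ρ hρ
      have h := (hasDerivAt_rotationKernel hf1 hf2 (hg' s1) (hg' s2) (hd s1) (hd s2)
        (by fun_prop) (by fun_prop) (Real.arccos ρ)).comp ρ
        (Real.hasDerivAt_arccos hρ.1.ne' hρ.2.ne)
      have hpos : 0 < √(1 - ρ ^ 2) := Real.sqrt_pos.2 (by nlinarith [hρ.1, hρ.2])
      convert! h.congr_of_eventuallyEq (f₁ := κ) _ using 1
      · rw [Real.sin_arccos]
        field_simp
      · filter_upwards [Icc_mem_nhds hρ.1 hρ.2] with r hr using hκK r hr
    have hbound : ∀ ρ ∈ Set.Ioo (-1 : ℝ) 1, |rotationKernel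
        (fun x ↦ s1 * deriv ψ (s1 * x)) (fun x ↦ s2 * deriv ψ (s2 * x)) (Real.arccos ρ)| ≤ M := by
      intro ρ hρ
      refine le_of_eq_of_le ?_ (hM ρ hρ)
      rw [hK (fun x ↦ deriv ψ (s1 * x)) (fun x ↦ deriv ψ (s2 * x)) (hdg.comp_const_mul s1)
        (hdg.comp_const_mul s2) (by fun_prop) (by fun_prop) ρ ⟨hρ.1.le, hρ.2.le⟩,
        ← abs_of_pos (mul_pos hs1 hs2), ← abs_mul, rotationKernel,
        rotationKernel, ← integral_const_mul]
      congr 2 with p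
      ring
    have hlt : ∀ a ∈ Set.Icc (-1 : ℝ) 1, ∀ b ∈ Set.Icc (-1 : ℝ) 1, a < b →
        |κ b - κ a| ≤ M * |b - a| := by
      intro a ha b hb hab
      obtain ⟨r, hr, hr'⟩ := exists_hasDerivAt_eq_slope κ _ hab
        (hcont.mono (Set.Icc_subset_Icc ha.1 hb.2))
        fun x hx ↦ hderiv x ⟨ha.1.trans_lt hx.1, hx.2.trans_le hb.2⟩
      have hM' := hbound r ⟨ha.1.trans_lt hr.1, hr.2.trans_le hb.2⟩
      rwa [hr', abs_div, div_le_iff₀ (abs_pos.2 (sub_pos.2 hab).ne')] at hM'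
    intro ρ0 h0 ρ1 h1
    rcases lt_trichotomy ρ0 ρ1 with h | rfl | h
    · exact hlt ρ0 h0 ρ1 h1 h
    · simp
    · rw [abs_sub_comm, abs_sub_comm ρ1]
      exact hlt ρ1 h1 ρ0 h0 h
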